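/- arXiv:1607.01117 — 2 statements merged into one kernel-verified Lean document; each statement's English description precedes it below -/
import Mathlib

section
/- For every integer h ≥ 0 there exists a tree T of radius h such that every anagram-free vertex colouring of T uses at least h colours (i.e. φ(T) ≥ h). -/
/-- A word is an *anagram* if it has the form `w₁ ++ w₂` where `w₁` is non-empty
and `w₂` is a permutation of `w₁`. -/
def IsAnagram {α : Type*} (l : List α) : Prop :=
  ∃ w₁ w₂ : List α, w₁ ≠ [] ∧ List.Perm w₁ w₂ ∧ l = w₁ ++ w₂

/-- A word is a *`k`-anagram* if it is a concatenation of `k` permutations of a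
fixed non-empty word `W`. -/
def IsKAnagram {α : Type*} (k : ℕ) (l : List α) : Prop :=
  ∃ (W : List α) (ws : List (List α)), W ≠ [] ∧ ws.length = k ∧
    (∀ w ∈ ws, List.Perm w W) ∧ l = ws.flatten

/-- A vertex colouring `f` of a graph `G` is *anagram-free* if the colour
sequence on the vertices of every path of `G` is not an anagram. -/
def AnagramFreeVC {V C : Type*} (G : SimpleGraph V) (f : V → C) : Prop :=
  ∀ ⦃u v : V⦄ (p : G.Walk u v), p.IsPath → ¬ IsAnagram (p.support.map f)

/-- An edge colouring `f` of a graph `G` is *anagram-free* if the colour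
sequence on the edges of every path of `G` is not an anagram. -/
def AnagramFreeEC {V C : Type*} (G : SimpleGraph V) (f : Sym2 V → C) : Prop :=
  ∀ ⦃u v : V⦄ (p : G.Walk u v), p.IsPath → ¬ IsAnagram (p.edges.map f)

/-- A vertex colouring `f` of a graph `G` is *`k`-anagram-free* if the colour
sequence on the vertices of every path of `G` is not a `k`-anagram. -/
def KAnagramFreeVC {V C : Type*} (k : ℕ) (G : SimpleGraph V) (f : V → C) : Prop :=
  ∀ ⦃u v : V⦄ (p : G.Walk u v), p.IsPath → ¬ IsKAnagram k (p.support.map f)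

/-- An edge colouring `f` of a graph `G` is *`k`-anagram-free* if the colour
sequence on the edges of every path of `G` is not a `k`-anagram. -/
def KAnagramFreeEC {V C : Type*} (k : ℕ) (G : SimpleGraph V) (f : Sym2 V → C) : Prop :=
  ∀ ⦃u v : V⦄ (p : G.Walk u v), p.IsPath → ¬ IsKAnagram k (p.edges.map f)

/-- The vertex set of the complete `d`-ary tree of height `h`: sequences of
branching choices of length at most `h` (the root is the empty list and the
leaves are the lists of length exactly `h`). -/
abbrev daryVertex (d h : ℕ) : Type := {l : List (Fin d) // l.length ≤ h}

/-- The complete `d`-ary tree of height `h`: every internal vertex has `d`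
children and every leaf is at distance `h` from the root. -/
def daryTree (d h : ℕ) : SimpleGraph (daryVertex d h) :=
  SimpleGraph.fromRel (fun x y => ∃ a : Fin d, y.1 = a :: x.1)

/-- `HasPathDecomp G w` means `G` has a path decomposition of width at most `w`:
a sequence of bags covering all vertices and edges, where the bags containing a
fixed vertex form a contiguous interval and each bag has at most `w + 1`
vertices.  Thus `HasPathDecomp G w` says that the pathwidth of `G` is at
most `w`. -/
def HasPathDecomp {V : Type*} (G : SimpleGraph V) (w : ℕ) : Prop :=
  ∃ (n : ℕ) (B : Fin n → Finset V),
    (∀ v : V, ∃ i, v ∈ B i) ∧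
    (∀ ⦃u v : V⦄, G.Adj u v → ∃ i, u ∈ B i ∧ v ∈ B i) ∧
    (∀ (v : V) (i j k : Fin n), i ≤ j → j ≤ k → v ∈ B i → v ∈ B k → v ∈ B j) ∧
    (∀ i, (B i).card ≤ w + 1)

/-- Every vertex of the spine has two children carrying the same colour word. -/
def Spine {d c : ℕ} (f : List (Fin d) → Fin c) : List (Fin c) → List (Fin d) → Prop
  | [], _ => True
  | x :: W, v => f v = x ∧ ∃ a b, a ≠ b ∧ Spine f W (a :: v) ∧ Spine f W (b :: v)

theorem exists_spine {d c : ℕ} (f : List (Fin d) → Fin c) (n : ℕ)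
    (hd : ∀ m < n, c ^ m < d) (v : List (Fin d)) :
    ∃ W : List (Fin c), W.length = n ∧ Spine f W v := by
  induction n generalizing v with
  | zero => exact ⟨[], rfl, trivial⟩
  | succ n ih =>
    have ih' := fun a : Fin d => ih (fun m hm => hd m (by omega)) (a :: v)
    choose g hg1 hg2 using ih'
    obtain ⟨a, b, hab, he⟩ := Fintype.exists_ne_map_eq_of_card_lt
      (β := List.Vector (Fin c) n) (fun a : Fin d => ⟨g a, hg1 a⟩)
      (by rw [card_vector]; simpa using hd n (by omega))
    have he' : g a = g b := congrArg Subtype.val he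
    exact ⟨f v :: g a, by simp [hg1], rfl, a, b, hab, hg2 a, he' ▸ hg2 b⟩

/-- The parent-child relation on lists. -/
def ChildRel {d : ℕ} (x y : List (Fin d)) : Prop := ∃ a : Fin d, y = a :: x

theorem spine_chain {d c : ℕ} (f : List (Fin d) → Fin c) (W : List (Fin c))
    (p : List (Fin d)) (a : Fin d) (hs : Spine f W (a :: p)) :
    ∃ L : List (List (Fin d)), L.map f = W ∧ (p :: L).IsChain ChildRel ∧
      (∀ x ∈ L, (a :: p) <:+ x ∧ x.length < (a :: p).length + W.length) ∧
      L.Nodup := by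
  induction W generalizing p a with
  | nil => exact ⟨[], by simp⟩
  | cons x W ih =>
    obtain ⟨hx, b, -, -, hb, -⟩ := hs
    obtain ⟨L, h1, h2, h3, h4⟩ := ih _ _ hb
    refine ⟨(a :: p) :: L, by simp [h1, hx], ?_, ?_, ?_⟩
    · exact List.IsChain.cons_cons ⟨a, rfl⟩ h2
    · intro y hy
      rcases List.mem_cons.1 hy with rfl | hy
      · simp
      · obtain ⟨h5, h6⟩ := h3 y hy
        refine ⟨(List.suffix_cons _ _).trans h5, ?_⟩
        simp at h6 ⊢
        omega
    · refine List.nodup_cons.2 ⟨fun hm => ?_, h4⟩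
      have := (h3 _ hm).1.length_le
      simp at this

theorem exists_anagram_list {d c : ℕ} (f : List (Fin d) → Fin c) (W : List (Fin c))
    (v : List (Fin d)) (hs : Spine f W v) (hW : ¬ W.Nodup) :
    ∃ P : List (List (Fin d)), P.IsChain (fun x y => ChildRel x y ∨ ChildRel y x) ∧ P.Nodup ∧
      (∀ x ∈ P, x.length < v.length + W.length) ∧ IsAnagram (P.map f) := by
  induction W generalizing v with
  | nil => simp at hW
  | cons x W ih =>
    obtain ⟨hx, a, b, hab, ha, hb⟩ := hs
    by_cases hn : W.Nodup
    · have hxW : x ∈ W := by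
        by_contra h
        exact hW (List.nodup_cons.2 ⟨h, hn⟩)
      obtain ⟨W1, W2, rfl⟩ := List.append_of_mem hxW
      obtain ⟨A, a1, a2, a3, a4⟩ := spine_chain f _ _ _ ha
      obtain ⟨B, b1, b2, b3, b4⟩ := spine_chain f _ _ _ hb
      obtain ⟨A1, A', rfl, rA1, rA'⟩ := List.map_eq_append_iff.1 a1
      obtain ⟨z, A2, rfl, hz, -⟩ := List.map_eq_cons_iff.1 rA'
      obtain ⟨B1, B2, rfl, rB1, -⟩ := List.map_eq_append_iff.1 b1
      have hA : (v :: (A1 ++ [z])).IsChain ChildRel := by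
        refine a2.prefix ⟨A2, by simp⟩
      have hB : (v :: B1).IsChain ChildRel := b2.prefix ⟨B2, by simp⟩
      have hvl : ∀ t : Fin d, ∀ y : List (Fin d), (t :: v) <:+ y → y ≠ v := by
        rintro t y h rfl
        have := h.length_le
        simp at this
      refine ⟨((A1 ++ [z]).reverse ++ [v]) ++ B1, ?_, ?_, ?_, ?_⟩
      · refine List.IsChain.append_overlap (l₂ := [v]) ?_ ?_ (by simp)
        · have : (A1 ++ [z]).reverse ++ [v] = (v :: (A1 ++ [z])).reverse := by simp
          rw [this, List.isChain_reverse]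
          exact hA.imp fun _ _ h => Or.inr h
        · exact hB.imp fun _ _ h => Or.inl h
      · have hAn : (A1 ++ [z]).Nodup := by
          refine a4.sublist (List.IsPrefix.sublist ⟨A2, by simp⟩)
        have hBn : B1.Nodup := b4.sublist (List.sublist_append_left _ _)
        rw [List.append_assoc, List.nodup_append]
        refine ⟨List.nodup_reverse.2 hAn, ?_, ?_⟩
        · refine List.nodup_cons.2 ⟨fun hm => ?_, hBn⟩
          exact hvl b v (b3 v (List.mem_append_left _ hm)).1 rfl
        · rintro y hy w hw rfl
          have hy' := (a3 y (by simp at hy ⊢; tauto)).1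
          rcases List.mem_cons.1 hw with rfl | hw
          · exact hvl a _ hy' rfl
          · have hy2 := (b3 y (by simp at hw ⊢; tauto)).1
            have := (List.suffix_of_suffix_length_le hy' hy2 (by simp)).eq_of_length (by simp)
            simp at this
            exact hab this
      · intro y hy
        have h1 : y ∈ A1 ++ z :: A2 ∨ y = v ∨ y ∈ B1 ++ B2 := by
          simp at hy ⊢; tauto
        rcases h1 with h | rfl | h
        · have := (a3 y h).2
          simp at this ⊢; omega
        · simp
        · have := (b3 y h).2
          simp at this ⊢; omega
      · refine ⟨x :: W1.reverse, x :: W1, by simp, ?_, ?_⟩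
        · exact (List.reverse_perm W1).cons x
        · simp [rA1, rB1, hx, hz]
    · obtain ⟨P, p1, p2, p3, p4⟩ := ih _ ha hn
      refine ⟨P, p1, p2, fun y hy => ?_, p4⟩
      have := p3 y hy
      simp at this ⊢
      omega

theorem exists_walk_of_chain {V : Type*} (G : SimpleGraph V) (u : V) (L : List V)
    (hL : (u :: L).IsChain G.Adj) : ∃ (v : V) (p : G.Walk u v), p.support = u :: L := by
  induction L generalizing u with
  | nil => exact ⟨u, .nil, rfl⟩
  | cons w L ih =>
    rw [List.isChain_cons_cons] at hL
    obtain ⟨v, p, hp⟩ := ih w hL.2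
    exact ⟨v, .cons hL.1 p, by simp [hp]⟩

theorem daryTree_adj {d h : ℕ} (x y : daryVertex d h) :
    (daryTree d h).Adj x y ↔ ChildRel x.1 y.1 ∨ ChildRel y.1 x.1 := by
  unfold daryTree
  rw [SimpleGraph.fromRel_adj]
  refine ⟨fun H => H.2, fun H => ⟨?_, H⟩⟩
  rintro rfl
  rcases H with ⟨a, H⟩ | ⟨a, H⟩ <;> simpa using congrArg List.length H

theorem daryTree_not_anagramFree {d h c : ℕ} (hc : c < h) (hd : ∀ m < h + 1, c ^ m < d)
    (f : daryVertex d h → Fin c) : ¬ AnagramFreeVC (daryTree d h) f := by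
  intro hf
  let g : List (Fin d) → Fin c := fun l => if hl : l.length ≤ h then f ⟨l, hl⟩ else f ⟨[], by simp⟩
  obtain ⟨W, hW, hs⟩ := exists_spine g (h + 1) hd []
  have hn : ¬ W.Nodup := by
    intro hn
    have := hn.length_le_card
    simp at this
    omega
  obtain ⟨P, p1, p2, p3, p4⟩ := exists_anagram_list g W [] hs hn
  have hP : ∀ x ∈ P, x.length ≤ h := by
    intro x hx
    have := p3 x hx
    simp at this
    omega
  lift P to List (daryVertex d h) using hP
  have hg : (P.map Subtype.val).map g = P.map f := by
    rw [List.map_map]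
    refine List.map_congr_left fun x _ => ?_
    have := x.2
    simp [g, this]
  rw [hg] at p4
  have p1' : P.IsChain (daryTree d h).Adj := by
    rw [List.isChain_map] at p1
    exact p1.imp fun x y h => (daryTree_adj x y).2 h
  have p2' : P.Nodup := List.Nodup.of_map _ p2
  cases P with
  | nil =>
    obtain ⟨w1, w2, h1, -, h3⟩ := p4
    simp at h3
    exact h1 h3.1
  | cons u L =>
    obtain ⟨v, p, hp⟩ := exists_walk_of_chain _ _ _ p1'
    refine hf p ?_ (hp ▸ p4)
    rw [SimpleGraph.Walk.isPath_def, hp]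
    exact p2'

instance daryVertex_finite (d h : ℕ) : Finite (daryVertex d h) :=
  (List.finite_length_le (Fin d) h).to_subtype

theorem daryTree_walk_root {d h : ℕ} (l : List (Fin d)) (hl : l.length ≤ h) :
    ∃ p : (daryTree d h).Walk ⟨[], by simp⟩ ⟨l, hl⟩, p.length = l.length := by
  induction l with
  | nil => exact ⟨.nil, rfl⟩
  | cons a l ih =>
    obtain ⟨p, hp⟩ := ih (by simp at hl; omega)
    exact ⟨p.concat ((daryTree_adj _ _).2 (Or.inl ⟨a, rfl⟩)), by simp [hp]⟩

theorem daryTree_connected (d h : ℕ) : (daryTree d h).Connected := by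
  have key : ∀ x : daryVertex d h, (daryTree d h).Reachable ⟨[], by simp⟩ x := fun x =>
    (daryTree_walk_root x.1 x.2).elim fun p _ => ⟨p⟩
  haveI : Nonempty (daryVertex d h) := ⟨⟨[], by simp⟩⟩
  exact ⟨fun x y => (key x).symm.trans (key y)⟩

theorem daryTree_isTree (d h : ℕ) : (daryTree d h).IsTree := by
  rw [SimpleGraph.isTree_iff_connected_and_card]
  refine ⟨daryTree_connected d h, ?_⟩
  refine le_antisymm ?_ (daryTree_connected d h).card_vert_le_card_edgeSet_add_one
  let par : daryVertex d h → daryVertex d h := fun x => ⟨x.1.tail, by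
    have := x.2; simp; omega⟩
  let r : daryVertex d h := ⟨[], by simp⟩
  have hsub : (daryTree d h).edgeSet ⊆ (fun x => s(x, par x)) '' ({r}ᶜ : Set (daryVertex d h)) := by
    intro e
    induction e with
    | h x y =>
      intro he
      rw [SimpleGraph.mem_edgeSet, daryTree_adj] at he
      rcases he with ⟨a, he⟩ | ⟨a, he⟩
      · refine ⟨y, ?_, ?_⟩
        · rintro rfl
          simp [r] at he
        · have : par y = x := Subtype.ext (by simp [par, he])
          simp only [this]
          exact Sym2.eq_swap
      · refine ⟨x, ?_, ?_⟩
        · rintro rfl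
          simp [r] at he
        · have : par x = y := Subtype.ext (by simp [par, he])
          simp only [this]
  have h1 := (Set.ncard_le_ncard hsub (Set.toFinite _)).trans (Set.ncard_image_le (Set.toFinite _))
  have h2 := Set.ncard_add_ncard_compl ({r} : Set (daryVertex d h))
  rw [Set.ncard_singleton] at h2
  rw [Nat.card_coe_set_eq]
  omega

theorem lipschitz_walk {V : Type*} {G : SimpleGraph V} (g : V → ℕ)
    (hg : ∀ x y, G.Adj x y → g y ≤ g x + 1) {u v : V} (p : G.Walk u v) :
    g v ≤ g u + p.length := by
  induction p with
  | nil => simp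
  | cons hadj p ih =>
    have := hg _ _ hadj
    simp
    omega

theorem daryTree_far {d h : ℕ} (hd : 2 ≤ d) (w : daryVertex d h) :
    ∃ u, h ≤ (daryTree d h).dist w u := by
  have : ∃ a : Fin d, w.1.getLast? ≠ some a := by
    by_contra! H
    have h0 := H ⟨0, by omega⟩
    rw [H ⟨1, by omega⟩] at h0
    simp at h0
  obtain ⟨a, ha⟩ := this
  rcases Nat.eq_zero_or_pos h with rfl | hh
  · exact ⟨w, by simp⟩
  refine ⟨⟨List.replicate h a, by simp⟩, ?_⟩
  let g : daryVertex d h → ℕ := fun x => if x.1.getLast? = some a then x.1.length else 0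
  obtain ⟨p, hp⟩ := (daryTree_connected d h).exists_walk_length_eq_dist w
    ⟨List.replicate h a, by simp⟩
  have := lipschitz_walk g (fun x y hxy => ?_) p
  · rw [hp] at this
    have h1 : g w = 0 := by simp [g, ha]
    have h2 : g ⟨List.replicate h a, by simp⟩ = h := by
      simp [g, List.getLast?_replicate]
      omega
    omega
  · obtain ⟨x, hx⟩ := x
    obtain ⟨y, hy⟩ := y
    rw [daryTree_adj] at hxy
    rcases hxy with ⟨b, rfl⟩ | ⟨b, rfl⟩
    · cases x with
      | nil => simp [g]; split_ifs <;> simp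
      | cons e x =>
        simp only [g, List.getLast?_cons_cons, List.length_cons]
        split_ifs <;> omega
    · cases y with
      | nil => simp [g]
      | cons e y =>
        simp only [g, List.getLast?_cons_cons, List.length_cons]
        split_ifs <;> omega

/-- For every `h ≥ 0` there is a tree of radius exactly `h`
whose every anagram-free vertex colouring uses at least `h` colours. -/
theorem exists_tree_radius_with_anagramFree_chromatic_ge (h : ℕ) :
    ∃ (V : Type) (G : SimpleGraph V), Finite V ∧ G.IsTree ∧
      (∃ v : V, (∀ u : V, G.dist v u ≤ h) ∧ ∀ w : V, ∃ u : V, h ≤ G.dist w u) ∧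
      ∀ c : ℕ, c < h → ∀ f : V → Fin c, ¬ AnagramFreeVC G f := by
  refine ⟨daryVertex ((h + 1) ^ h + 2) h, daryTree _ h, inferInstance, daryTree_isTree _ _,
    ⟨⟨[], by simp⟩, fun u => ?_, fun w => daryTree_far (by omega) w⟩, fun c hc f => ?_⟩
  · obtain ⟨p, hp⟩ := daryTree_walk_root u.1 u.2
    exact (SimpleGraph.dist_le p).trans (hp ▸ u.2)
  · refine daryTree_not_anagramFree hc (fun m hm => ?_) f
    have h1 : c ^ m ≤ (h + 1) ^ m := Nat.pow_le_pow_left (by omega) m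
    have h2 : (h + 1) ^ m ≤ (h + 1) ^ h := Nat.pow_le_pow_right (by omega) (by omega)
    omega
end

section
/- For every integer k ≥ 4, every tree T has a k-anagram-free vertex colouring using at most 4 colours, i.e. φ_k(T) ≤ 4. -/
/-- The `r`-th letter of Keränen's word of length 85 (two bits per letter). -/
def kg (r : ℕ) : ℕ := (227193366226236800249709662197971513346990172696100 >>> (2 * r)) % 4

/-- Number of letters `x` in the prefix of length `r` of Keränen's word (packed table). -/
def ksv (x r : ℕ) : ℕ := (192364792585579514640223809849697484116132052463140566022981331987653499662749155874347004496197567646596614450527379343904291950343051804972197406657814754241722331008165431918390451896185942433326810165211990336946259868021058854086827658918636917278056683327725632645293172446758366037724095801240147987117323856713675450263634845441301482476592910478378237425481771152863178510538594746988780140890515456425177863420900285503534831040448532469126576815643370095960147020582166169077439761816755368873902139218346621616794069593905061301556655047428192562167041251289838740477499449482555247927593012827901340690103387790469925043659920898771380443352811993422474153526606035637956930904306804825398566205155807184012263102421708206255320121381957091195520017836053958863875339211200212058441848727891372822684217057162035200 >>> (32 * r + 8 * x)) % 256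

/-- Packed table of the values of the linear functional modulo 43435. -/
def ktab (b r : ℕ) : ℕ := (26522367484137785294085252964358681972633382964028503254424737171233129222633353443358669308044916883337423958239634937063614346575344421007764040257642937426227702035601306242687388131314862213545416482130988285664918317389907285786027498036330367103343166682348013038365171806105455595775275209535597129723855776029180844981796640730427108875535235473379129570772936630817338351575795883346500171617076325418727474688356748718350242121807704771648281402381232526509792004602942466198473837125875820647780178679787148858804939682860433142665006426460670367797353621166933809330934496651385779683375392482601390597503543984523035148617968868106206386160612097658621500197764063709075579597269298457421319023870257940535183904344016897002224066246280386469412508201515453713700681573049603613357948852261430403510137321501871032327928190889008159934278357296584584005719651855894085782448500393254492614348765804448972117324700869781296991964239534497606773957134828558128359031670852355630252233954457693985967633155199610379606680821858900548226963198098248888537470499534311810490709038113442153170173110713052559612277911485272556469908000721441734957192153431172135401071966198719742785317786729658968499685576710903143256611118809817847806058884975554928240573211166380121982950685651160256472549648101526655077120982711309771065246962385409683872419107878471125604757072233907357760049848154736783341398583472866410032656021883530347062276861575319902178651736897778244225178713055962840285496921110309749242413393804029188798756342288072942861489134631503006935490060614522701105246510692346358783443077060645677147578542990622720 >>> (16 *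 (85 * b + r))) % 65536

def krel (x b : ℕ) : ℕ := (x + 4 - b) % 4

/-- Bounded universal quantifier as a Boolean. -/
def kall (n : ℕ) (p : ℕ → Bool) : Bool :=
  Nat.rec true (fun k ih => p k && ih) n

theorem kall_spec {n : ℕ} {p : ℕ → Bool} (h : kall n p = true) : ∀ i < n, p i = true := by
  induction n with
  | zero => intro i hi; omega
  | succ n ih =>
    have h' : (p n && kall n p) = true := h
    rw [Bool.and_eq_true] at h'
    intro i hi
    rcases Nat.lt_succ_iff_lt_or_eq.mp hi with h1 | h1
    · exact ih h'.2 i h1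
    · rw [h1]; exact h'.1

def kvec (r s t b c α β γ : ℕ) : Bool :=
  kall 4 fun x =>
    Nat.beq (ksv x r + ksv (krel x c) t + 2 * β * ksv (krel x b) 85)
      (2 * ksv (krel x b) s + α * ksv x 85 + γ * ksv (krel x c) 85)

def khit (r s t b c : ℕ) : Bool :=
  Nat.beq ((ktab 0 r + ktab c t + 2 * (43435 - ktab b s)) % 43435) 0

def kex (r s t b c : ℕ) : Bool :=
  kvec r s t b c 0 0 0 || kvec r s t b c 0 0 1 || kvec r s t b c 0 1 0 || kvec r s t b c 0 1 1 ||
  kvec r s t b c 1 0 0 || kvec r s t b c 1 0 1 || kvec r s t b c 1 1 0 || kvec r s t b c 1 1 1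

/-- `kvecS`: the abelian square equation for positions in at most two neighbouring blocks. -/
def kvecS (r s t b c β γ : ℕ) : Bool :=
  kall 4 fun x =>
    Nat.beq (ksv x r + ksv (krel x c) t + γ * ksv x 85)
      (2 * ksv (krel x b) s + 2 * β * ksv x 85)

def kshort (r s t b c : ℕ) : Bool :=
  !(Nat.beq b 0 && Nat.beq c 0 && Nat.blt r s && kvecS r s t b c 0 0) &&
  !(Nat.beq b 0 && !(Nat.beq c 0) && Nat.blt r s && kvecS r s t b c 0 1) &&
  !(!(Nat.beq b 0) && Nat.beq c b && kvecS r s t b c 1 1)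

def ktest (r s t b c : ℕ) : Bool :=
  !(khit r s t b c) || (kex r s t b c && kshort r s t b c)

def kcheck : Bool :=
  kall 85 fun r => kall 85 fun s => kall 4 fun b => kall 4 fun c =>
    ktest r s ((2 * s + 85 - r) % 85) b c

theorem kcheck_true : kcheck = true := by decide +kernel

theorem ksv_zero : ∀ x < 4, ksv x 0 = 0 := by decide +kernel

theorem ksv_full : ksv 0 85 = 19 ∧ ksv 1 85 = 21 ∧ ksv 2 85 = 27 ∧ ksv 3 85 = 18 := by
  decide +kernel

theorem ksv_succ : ∀ r < 85, ∀ x < 4, ksv x (r + 1) = ksv x r + if kg r = x then 1 else 0 := by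
  decide +kernel

theorem ktab_spec : ∀ b < 4, ∀ r < 85,
    (ksv (krel 0 b) r + 30176 * ksv (krel 1 b) r + 19636 * ksv (krel 2 b) r
      + 39101 * ksv (krel 3 b) r) % 43435 = ktab b r := by
  decide +kernel

theorem kg_adj : ∀ r < 84, kg r ≠ kg (r + 1) := by decide +kernel

theorem kg_lt (r : ℕ) : kg r < 4 := Nat.mod_lt _ (by norm_num)

/-- Keränen's abelian square-free word on four letters. -/
def kw (n : ℕ) : ℕ :=
  if h : n = 0 then 0 else (kw (n / 85) + kg (n % 85)) % 4
termination_by n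
decreasing_by omega

theorem kw_eq (n : ℕ) : kw n = (kw (n / 85) + kg (n % 85)) % 4 := by
  by_cases h : n = 0
  · subst h
    have h0 : kw 0 = 0 := by rw [kw]; simp
    have h1 : kg 0 = 0 := by decide +kernel
    simp [h0, h1]
  · conv_lhs => rw [kw]
    simp [h]

theorem kw_lt (n : ℕ) : kw n < 4 := by
  rw [kw_eq]; exact Nat.mod_lt _ (by norm_num)

theorem kw_block (q r : ℕ) (hr : r < 85) : kw (85 * q + r) = (kw q + kg r) % 4 := by
  rw [kw_eq]
  have h1 : (85 * q + r) / 85 = q := by omega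
  have h2 : (85 * q + r) % 85 = r := by omega
  rw [h1, h2]

theorem kw_adj (n : ℕ) : kw n ≠ kw (n + 1) := by
  induction n using Nat.strong_induction_on with
  | _ n ih =>
    obtain ⟨q, r, hr, rfl⟩ : ∃ q r, r < 85 ∧ n = 85 * q + r :=
      ⟨n / 85, n % 85, Nat.mod_lt _ (by norm_num), by omega⟩
    by_cases h : r < 84
    · rw [kw_block q r hr, add_assoc, kw_block q (r + 1) (by omega)]
      have := kg_adj r h
      have := kg_lt r
      have := kg_lt (r + 1)
      omega
    · have hr' : r = 84 := by omega
      subst hr'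
      have e : 85 * q + 84 + 1 = 85 * (q + 1) + 0 := by ring
      rw [kw_block q 84 hr, e, kw_block (q + 1) 0 (by norm_num)]
      have h1 : kg 0 = 0 := by decide +kernel
      have h2 : kg 84 = 0 := by decide +kernel
      have := ih q (by omega)
      have := kw_lt q
      have := kw_lt (q + 1)
      omega

/-- Number of occurrences of `x` among the first `n` letters of `kw`. -/
def kcnt (x : ℕ) : ℕ → ℕ
  | 0 => 0
  | n + 1 => kcnt x n + if kw n = x then 1 else 0

theorem krel_lt (x b : ℕ) : krel x b < 4 := Nat.mod_lt _ (by norm_num)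

theorem kcnt_block (x : ℕ) (hx : x < 4) (q r : ℕ) (hr : r ≤ 85) :
    kcnt x (85 * q + r) = kcnt x (85 * q) + ksv (krel x (kw q)) r := by
  induction r with
  | zero => simp [ksv_zero _ (krel_lt _ _)]
  | succ r ih =>
    rw [← add_assoc, kcnt, ih (by omega), ksv_succ r (by omega) _ (krel_lt _ _),
      kw_block q r (by omega), add_assoc]
    congr 2
    have := kg_lt r
    have := kw_lt q
    have : ((kw q + kg r) % 4 = x) ↔ (kg r = krel x (kw q)) := by
      unfold krel; omega
    simp only [this]

theorem kcnt_mul (q : ℕ) :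
    kcnt 0 (85 * q) = 19 * kcnt 0 q + 18 * kcnt 1 q + 27 * kcnt 2 q + 21 * kcnt 3 q ∧
    kcnt 1 (85 * q) = 21 * kcnt 0 q + 19 * kcnt 1 q + 18 * kcnt 2 q + 27 * kcnt 3 q ∧
    kcnt 2 (85 * q) = 27 * kcnt 0 q + 21 * kcnt 1 q + 19 * kcnt 2 q + 18 * kcnt 3 q ∧
    kcnt 3 (85 * q) = 18 * kcnt 0 q + 27 * kcnt 1 q + 21 * kcnt 2 q + 19 * kcnt 3 q := by
  obtain ⟨s0, s1, s2, s3⟩ := ksv_full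
  induction q with
  | zero => simp [kcnt]
  | succ q ih =>
    have e : 85 * (q + 1) = 85 * q + 85 := by ring
    rw [e, kcnt_block 0 (by norm_num) q 85 le_rfl, kcnt_block 1 (by norm_num) q 85 le_rfl,
      kcnt_block 2 (by norm_num) q 85 le_rfl, kcnt_block 3 (by norm_num) q 85 le_rfl]
    simp only [kcnt]
    obtain ⟨h0, h1, h2, h3⟩ := ih
    have hw := kw_lt q
    generalize kw q = a at *
    interval_cases a <;> simp [krel, s0, s1, s2, s3] <;> omega

theorem kcnt_sum (n : ℕ) : kcnt 0 n + kcnt 1 n + kcnt 2 n + kcnt 3 n = n := by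
  induction n with
  | zero => simp [kcnt]
  | succ n ih =>
    simp only [kcnt]
    have hw := kw_lt n
    generalize kw n = a at *
    interval_cases a <;> simp <;> omega

theorem kmat_inj (u0 u1 u2 u3 : ℤ) (h0 : 19 * u0 + 18 * u1 + 27 * u2 + 21 * u3 = 0)
    (h1 : 21 * u0 + 19 * u1 + 18 * u2 + 27 * u3 = 0)
    (h2 : 27 * u0 + 21 * u1 + 19 * u2 + 18 * u3 = 0)
    (h3 : 18 * u0 + 27 * u1 + 21 * u2 + 19 * u3 = 0) : u0 = 0 ∧ u1 = 0 ∧ u2 = 0 ∧ u3 = 0 := by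
  refine ⟨?_, ?_, ?_, ?_⟩ <;> linarith

theorem kmat_dvd (u0 u1 u2 u3 v0 v1 v2 v3 : ℤ)
    (h0 : 19 * u0 + 18 * u1 + 27 * u2 + 21 * u3 + v0 = 0)
    (h1 : 21 * u0 + 19 * u1 + 18 * u2 + 27 * u3 + v1 = 0)
    (h2 : 27 * u0 + 21 * u1 + 19 * u2 + 18 * u3 + v2 = 0)
    (h3 : 18 * u0 + 27 * u1 + 21 * u2 + 19 * u3 + v3 = 0) :
    (43435 : ℤ) ∣ v0 + 30176 * v1 + 19636 * v2 + 39101 * v3 :=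
  ⟨-(43 * u0 + 47 * u1 + 40 * u2 + 44 * u3), by linarith⟩

theorem kres (A B C T0 Tb Tc : ℕ) (h0 : A % 43435 = T0) (hb : B % 43435 = Tb)
    (hc : C % 43435 = Tc) (h : (43435 : ℤ) ∣ (A : ℤ) + C - 2 * B) :
    (T0 + Tc + 2 * (43435 - Tb)) % 43435 = 0 := by
  omega

theorem kcnt_inj (i j k : ℕ)
    (h : ∀ x < 4, kcnt x (85 * i) + kcnt x (85 * k) = 2 * kcnt x (85 * j)) :
    ∀ x < 4, kcnt x i + kcnt x k = 2 * kcnt x j := by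
  have h0 := h 0 (by norm_num)
  have h1 := h 1 (by norm_num)
  have h2 := h 2 (by norm_num)
  have h3 := h 3 (by norm_num)
  obtain ⟨a0, a1, a2, a3⟩ := kcnt_mul i
  obtain ⟨b0, b1, b2, b3⟩ := kcnt_mul j
  obtain ⟨c0, c1, c2, c3⟩ := kcnt_mul k
  obtain ⟨d0, d1, d2, d3⟩ := kmat_inj ((kcnt 0 i : ℤ) + kcnt 0 k - 2 * kcnt 0 j)
    ((kcnt 1 i : ℤ) + kcnt 1 k - 2 * kcnt 1 j) ((kcnt 2 i : ℤ) + kcnt 2 k - 2 * kcnt 2 j)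
    ((kcnt 3 i : ℤ) + kcnt 3 k - 2 * kcnt 3 j)
    (by linarith) (by linarith) (by linarith) (by linarith)
  clear h h0 h1 h2 h3 a0 a1 a2 a3 b0 b1 b2 b3 c0 c1 c2 c3
  intro x hx
  interval_cases x <;> omega

theorem kcheck_spec (r s t b c : ℕ) (hr : r < 85) (hs : s < 85) (hb : b < 4) (hc : c < 4)
    (ht : t < 85) (hrst : (r + t) % 85 = (2 * s) % 85) (hhit : khit r s t b c = true) :
    kex r s t b c = true ∧ kshort r s t b c = true := by
  have h := kall_spec (kall_spec (kall_spec (kall_spec kcheck_true r hr) s hs) b hb) c hc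
  have e : (2 * s + 85 - r) % 85 = t := by omega
  simp only [e] at h
  unfold ktest at h
  rw [hhit] at h
  simpa using h

theorem kvec_spec {r s t b c α β γ : ℕ} (h : kvec r s t b c α β γ = true) : ∀ x < 4,
    ksv x r + ksv (krel x c) t + 2 * β * ksv (krel x b) 85
      = 2 * ksv (krel x b) s + α * ksv x 85 + γ * ksv (krel x c) 85 := fun x hx =>
  Nat.eq_of_beq_eq_true (kall_spec h x hx)

theorem kex_spec {r s t b c : ℕ} (h : kex r s t b c = true) : ∃ α β γ, α ≤ 1 ∧ β ≤ 1 ∧ γ ≤ 1 ∧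
    kvec r s t b c α β γ = true := by
  unfold kex at h
  simp only [Bool.or_eq_true] at h
  rcases h with ((((((h | h) | h) | h) | h) | h) | h) | h <;>
    exact ⟨_, _, _, by norm_num, by norm_num, by norm_num, h⟩

theorem kvecS_of {r s t b c β γ : ℕ} (h : ∀ x < 4,
    ksv x r + ksv (krel x c) t + γ * ksv x 85
      = 2 * ksv (krel x b) s + 2 * β * ksv x 85) : kvecS r s t b c β γ = true := by
  have : ∀ n ≤ 4, kall n (fun x =>
    Nat.beq (ksv x r + ksv (krel x c) t + γ * ksv x 85)
      (2 * ksv (krel x b) s + 2 * β * ksv x 85)) = true := by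
    intro n hn
    induction n with
    | zero => rfl
    | succ n ih =>
      change (_ && kall n _) = true
      rw [Bool.and_eq_true]
      refine ⟨?_, ih (by omega)⟩
      beta_reduce
      rw [h n (by omega)]
      exact Nat.beq_refl _
  exact this 4 le_rfl

theorem krel_krel (x a b : ℕ) (ha : a < 4) (hb : b < 4) :
    krel (krel x a) (krel b a) = krel x b := by
  unfold krel; omega

set_option maxHeartbeats 2000000 in
theorem khit_of (qi qj qk r s t : ℕ) (hr : r < 85) (hs : s < 85) (ht : t < 85)
    (h : ∀ x < 4, kcnt x (85 * qi + r) + kcnt x (85 * qk + t) = 2 * kcnt x (85 * qj + s)) :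
    khit r s t (krel (kw qj) (kw qi)) (krel (kw qk) (kw qi)) = true := by
  have h0 := h 0 (by norm_num)
  have h1 := h 1 (by norm_num)
  have h2 := h 2 (by norm_num)
  have h3 := h 3 (by norm_num)
  obtain ⟨a0, a1, a2, a3⟩ := kcnt_mul qi
  obtain ⟨b0, b1, b2, b3⟩ := kcnt_mul qj
  obtain ⟨c0, c1, c2, c3⟩ := kcnt_mul qk
  rw [kcnt_block _ (by norm_num) _ _ hr.le, kcnt_block _ (by norm_num) _ _ hs.le,
    kcnt_block _ (by norm_num) _ _ ht.le] at h0 h1 h2 h3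
  have t0 := ktab_spec 0 (by norm_num) r hr
  have tb := ktab_spec (krel (kw qj) (kw qi)) (krel_lt _ _) s hs
  have tc := ktab_spec (krel (kw qk) (kw qi)) (krel_lt _ _) t ht
  have ha := kw_lt qi
  have hb := kw_lt qj
  have hc := kw_lt qk
  unfold khit
  suffices H : (ktab 0 r + ktab (krel (kw qk) (kw qi)) t +
      2 * (43435 - ktab (krel (kw qj) (kw qi)) s)) % 43435 = 0 by
    rw [H]; rfl
  generalize ktab 0 r = T0 at *
  generalize ktab (krel (kw qk) (kw qi)) t = Tc at *
  generalize ktab (krel (kw qj) (kw qi)) s = Tb at *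
  rw [a0, b0, c0] at h0
  rw [a1, b1, c1] at h1
  rw [a2, b2, c2] at h2
  rw [a3, b3, c3] at h3
  clear a0 a1 a2 a3 b0 b1 b2 b3 c0 c1 c2 c3 h
  rw [show krel 0 0 = 0 from rfl, show krel 1 0 = 1 from rfl, show krel 2 0 = 2 from rfl,
    show krel 3 0 = 3 from rfl] at t0
  generalize kw qi = a at *
  generalize kw qj = b at *
  generalize kw qk = c at *
  have e (x y : ℕ) (hx : x < 4) (hy : y < 4) : krel x (krel y a) = krel ((x + a) % 4) y := by
    unfold krel; omega
  simp only [e _ _ (show 0 < 4 by norm_num) hb, e _ _ (show 1 < 4 by norm_num) hb,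
    e _ _ (show 2 < 4 by norm_num) hb, e _ _ (show 3 < 4 by norm_num) hb] at tb
  simp only [e _ _ (show 0 < 4 by norm_num) hc, e _ _ (show 1 < 4 by norm_num) hc,
    e _ _ (show 2 < 4 by norm_num) hc, e _ _ (show 3 < 4 by norm_num) hc] at tc
  clear e
  interval_cases a
  · simp only [Nat.reduceAdd, Nat.reduceMod] at tb tc
    rw [show krel 0 0 = 0 from rfl] at h0
    rw [show krel 1 0 = 1 from rfl] at h1
    rw [show krel 2 0 = 2 from rfl] at h2
    rw [show krel 3 0 = 3 from rfl] at h3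
    generalize ksv (krel 0 b) s = B0 at *
    generalize ksv (krel 1 b) s = B1 at *
    generalize ksv (krel 2 b) s = B2 at *
    generalize ksv (krel 3 b) s = B3 at *
    generalize ksv (krel 0 c) t = C0 at *
    generalize ksv (krel 1 c) t = C1 at *
    generalize ksv (krel 2 c) t = C2 at *
    generalize ksv (krel 3 c) t = C3 at *
    have hd := kmat_dvd ((kcnt 0 qi : ℤ) + kcnt 0 qk - 2 * kcnt 0 qj)
      ((kcnt 1 qi : ℤ) + kcnt 1 qk - 2 * kcnt 1 qj)
      ((kcnt 2 qi : ℤ) + kcnt 2 qk - 2 * kcnt 2 qj)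
      ((kcnt 3 qi : ℤ) + kcnt 3 qk - 2 * kcnt 3 qj)
      ((ksv 0 r : ℤ) + C0 - 2 * B0)
      ((ksv 1 r : ℤ) + C1 - 2 * B1)
      ((ksv 2 r : ℤ) + C2 - 2 * B2)
      ((ksv 3 r : ℤ) + C3 - 2 * B3)
      (by linarith) (by linarith) (by linarith) (by linarith)
    refine kres _ _ _ _ _ _ t0 tb tc ?_
    push_cast
    convert hd using 1
    ring
  · simp only [Nat.reduceAdd, Nat.reduceMod] at tb tc
    rw [show krel 0 1 = 3 from rfl] at h0
    rw [show krel 1 1 = 0 from rfl] at h1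
    rw [show krel 2 1 = 1 from rfl] at h2
    rw [show krel 3 1 = 2 from rfl] at h3
    generalize ksv (krel 0 b) s = B0 at *
    generalize ksv (krel 1 b) s = B1 at *
    generalize ksv (krel 2 b) s = B2 at *
    generalize ksv (krel 3 b) s = B3 at *
    generalize ksv (krel 0 c) t = C0 at *
    generalize ksv (krel 1 c) t = C1 at *
    generalize ksv (krel 2 c) t = C2 at *
    generalize ksv (krel 3 c) t = C3 at *
    have hd := kmat_dvd ((kcnt 1 qi : ℤ) + kcnt 1 qk - 2 * kcnt 1 qj)
      ((kcnt 2 qi : ℤ) + kcnt 2 qk - 2 * kcnt 2 qj)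
      ((kcnt 3 qi : ℤ) + kcnt 3 qk - 2 * kcnt 3 qj)
      ((kcnt 0 qi : ℤ) + kcnt 0 qk - 2 * kcnt 0 qj)
      ((ksv 0 r : ℤ) + C1 - 2 * B1)
      ((ksv 1 r : ℤ) + C2 - 2 * B2)
      ((ksv 2 r : ℤ) + C3 - 2 * B3)
      ((ksv 3 r : ℤ) + C0 - 2 * B0)
      (by linarith) (by linarith) (by linarith) (by linarith)
    refine kres _ _ _ _ _ _ t0 tb tc ?_
    push_cast
    convert hd using 1
    ring
  · simp only [Nat.reduceAdd, Nat.reduceMod] at tb tc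
    rw [show krel 0 2 = 2 from rfl] at h0
    rw [show krel 1 2 = 3 from rfl] at h1
    rw [show krel 2 2 = 0 from rfl] at h2
    rw [show krel 3 2 = 1 from rfl] at h3
    generalize ksv (krel 0 b) s = B0 at *
    generalize ksv (krel 1 b) s = B1 at *
    generalize ksv (krel 2 b) s = B2 at *
    generalize ksv (krel 3 b) s = B3 at *
    generalize ksv (krel 0 c) t = C0 at *
    generalize ksv (krel 1 c) t = C1 at *
    generalize ksv (krel 2 c) t = C2 at *
    generalize ksv (krel 3 c) t = C3 at *
    have hd := kmat_dvd ((kcnt 2 qi : ℤ) + kcnt 2 qk - 2 * kcnt 2 qj)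
      ((kcnt 3 qi : ℤ) + kcnt 3 qk - 2 * kcnt 3 qj)
      ((kcnt 0 qi : ℤ) + kcnt 0 qk - 2 * kcnt 0 qj)
      ((kcnt 1 qi : ℤ) + kcnt 1 qk - 2 * kcnt 1 qj)
      ((ksv 0 r : ℤ) + C2 - 2 * B2)
      ((ksv 1 r : ℤ) + C3 - 2 * B3)
      ((ksv 2 r : ℤ) + C0 - 2 * B0)
      ((ksv 3 r : ℤ) + C1 - 2 * B1)
      (by linarith) (by linarith) (by linarith) (by linarith)
    refine kres _ _ _ _ _ _ t0 tb tc ?_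
    push_cast
    convert hd using 1
    ring
  · simp only [Nat.reduceAdd, Nat.reduceMod] at tb tc
    rw [show krel 0 3 = 1 from rfl] at h0
    rw [show krel 1 3 = 2 from rfl] at h1
    rw [show krel 2 3 = 3 from rfl] at h2
    rw [show krel 3 3 = 0 from rfl] at h3
    generalize ksv (krel 0 b) s = B0 at *
    generalize ksv (krel 1 b) s = B1 at *
    generalize ksv (krel 2 b) s = B2 at *
    generalize ksv (krel 3 b) s = B3 at *
    generalize ksv (krel 0 c) t = C0 at *
    generalize ksv (krel 1 c) t = C1 at *
    generalize ksv (krel 2 c) t = C2 at *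
    generalize ksv (krel 3 c) t = C3 at *
    have hd := kmat_dvd ((kcnt 3 qi : ℤ) + kcnt 3 qk - 2 * kcnt 3 qj)
      ((kcnt 0 qi : ℤ) + kcnt 0 qk - 2 * kcnt 0 qj)
      ((kcnt 1 qi : ℤ) + kcnt 1 qk - 2 * kcnt 1 qj)
      ((kcnt 2 qi : ℤ) + kcnt 2 qk - 2 * kcnt 2 qj)
      ((ksv 0 r : ℤ) + C3 - 2 * B3)
      ((ksv 1 r : ℤ) + C0 - 2 * B0)
      ((ksv 2 r : ℤ) + C1 - 2 * B1)
      ((ksv 3 r : ℤ) + C2 - 2 * B2)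
      (by linarith) (by linarith) (by linarith) (by linarith)
    refine kres _ _ _ _ _ _ t0 tb tc ?_
    push_cast
    convert hd using 1
    ring


theorem kcnt_step (x : ℕ) (hx : x < 4) (q α : ℕ) (hα : α ≤ 1) :
    kcnt x (85 * (q + α)) = kcnt x (85 * q) + α * ksv (krel x (kw q)) 85 := by
  interval_cases α
  · simp
  · rw [one_mul, ← kcnt_block x hx q 85 le_rfl, mul_add]

/-- Keränen's word contains no abelian square. -/
theorem kw_noAP : ∀ k i j : ℕ, i < j → i + k = 2 * j →
    (∀ x < 4, kcnt x i + kcnt x k = 2 * kcnt x j) → False := by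
  intro k
  induction k using Nat.strong_induction_on with
  | _ k ih =>
    intro i j hij hsum h
    obtain ⟨qi, r, hr, rfl⟩ : ∃ q r, r < 85 ∧ i = 85 * q + r :=
      ⟨i / 85, i % 85, Nat.mod_lt _ (by norm_num), by omega⟩
    obtain ⟨qj, s, hs, rfl⟩ : ∃ q r, r < 85 ∧ j = 85 * q + r :=
      ⟨j / 85, j % 85, Nat.mod_lt _ (by norm_num), by omega⟩
    obtain ⟨qk, t, ht, rfl⟩ : ∃ q r, r < 85 ∧ k = 85 * q + r :=
      ⟨k / 85, k % 85, Nat.mod_lt _ (by norm_num), by omega⟩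
    have hit := khit_of qi qj qk r s t hr hs ht h
    have hai := kw_lt qi
    have haj := kw_lt qj
    have hak := kw_lt qk
    obtain ⟨hex, hshort⟩ := kcheck_spec r s t _ _ hr hs (krel_lt (kw qj) (kw qi))
      (krel_lt (kw qk) (kw qi)) ht (by omega) hit
    obtain ⟨α, β, γ, hα, hβ, hγ, hv⟩ := kex_spec hex
    have hv := kvec_spec hv
    have hdesc := kcnt_inj (qi + α) (qj + β) (qk + γ) (by
      intro x hx
      rw [kcnt_step x hx _ _ hα, kcnt_step x hx _ _ hβ, kcnt_step x hx _ _ hγ]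
      have h1 := hv (krel x (kw qi)) (krel_lt _ _)
      rw [krel_krel _ _ _ hai haj, krel_krel _ _ _ hai hak] at h1
      have h2 := h x hx
      rw [kcnt_block x hx _ _ hr.le, kcnt_block x hx _ _ hs.le, kcnt_block x hx _ _ ht.le] at h2
      rw [mul_assoc] at h1
      linarith)
    have hs1 := kcnt_sum (qi + α)
    have hs2 := kcnt_sum (qj + β)
    have hs3 := kcnt_sum (qk + γ)
    have d0 := hdesc 0 (by norm_num)
    have d1 := hdesc 1 (by norm_num)
    have d2 := hdesc 2 (by norm_num)
    have d3 := hdesc 3 (by norm_num)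
    have hsum' : (qi + α) + (qk + γ) = 2 * (qj + β) := by linarith
    clear hs1 hs2 hs3 d0 d1 d2 d3
    by_cases hlt : qi + α < qj + β
    · exact ih (qk + γ) (by omega) _ _ hlt hsum' hdesc
    · have hid : ∀ x < 4, ∃ y, y < 4 ∧ krel y (kw qi) = x ∧
          kcnt y (85 * qi) + ksv x r + (kcnt y (85 * qk) + ksv (krel x (krel (kw qk) (kw qi))) t)
            = 2 * (kcnt y (85 * qj) + ksv (krel x (krel (kw qj) (kw qi))) s) := by
        intro x hx
        have hy : (x + kw qi) % 4 < 4 := Nat.mod_lt _ (by norm_num)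
        have hyx : krel ((x + kw qi) % 4) (kw qi) = x := by unfold krel; omega
        refine ⟨(x + kw qi) % 4, hy, hyx, ?_⟩
        generalize (x + kw qi) % 4 = y at hy hyx
        have h2 := h y hy
        rw [kcnt_block y hy _ _ hr.le, kcnt_block y hy _ _ hs.le, kcnt_block y hy _ _ ht.le] at h2
        rw [← hyx, krel_krel _ _ _ hai haj, krel_krel _ _ _ hai hak]
        exact h2
      have hstep : ∀ y < 4, kcnt y (85 * (qi + 1)) =
          kcnt y (85 * qi) + ksv (krel y (kw qi)) 85 := by
        intro y hy
        have := kcnt_step y hy qi 1 le_rfl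
        rwa [one_mul] at this
      have hself : krel (kw qi) (kw qi) = 0 := by unfold krel; omega
      have hne : krel (kw (qi + 1)) (kw qi) ≠ 0 := by
        have := kw_adj qi
        have := kw_lt (qi + 1)
        unfold krel; omega
      unfold kshort at hshort
      simp only [Bool.and_eq_true, Bool.not_eq_true', Bool.and_eq_false_imp] at hshort
      obtain ⟨⟨hA, hB⟩, hC⟩ := hshort
      have hcase : (qj = qi ∧ qk = qi) ∨ (qj = qi ∧ qk = qi + 1) ∨
        (qj = qi + 1 ∧ qk = qi + 1) := by omega
      rcases hcase with ⟨rfl, rfl⟩ | ⟨rfl, rfl⟩ | ⟨rfl, rfl⟩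
      · rw [hself] at hid hA
        have hv' : kvecS r s t 0 0 0 0 = true := kvecS_of (by
          intro x hx
          obtain ⟨y, hy, hyx, e⟩ := hid x hx
          linarith)
        have hrs : Nat.blt r s = true := by rw [Nat.blt_eq]; omega
        simp [hv', hrs] at hA
      · rw [hself] at hid hB
        have hv' : kvecS r s t 0 (krel (kw (qj + 1)) (kw qj)) 0 1 = true := kvecS_of (by
          intro x hx
          obtain ⟨y, hy, hyx, e⟩ := hid x hx
          rw [hstep y hy, hyx] at e
          linarith)
        have hrs : Nat.blt r s = true := by rw [Nat.blt_eq]; omega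
        simp [hv', hrs, hne] at hB
      · have hv' : kvecS r s t (krel (kw (qi + 1)) (kw qi)) (krel (kw (qi + 1)) (kw qi)) 1 1
            = true := kvecS_of (by
          intro x hx
          obtain ⟨y, hy, hyx, e⟩ := hid x hx
          rw [hstep y hy, hyx] at e
          linarith)
        simp [hv', hne] at hC

/-- The letters of Keränen's word as elements of `Fin 4`. -/
def kcol (n : ℕ) : Fin 4 := ⟨kw n, kw_lt n⟩

theorem kcol_count (x : Fin 4) (i n : ℕ) :
    kcnt x i + ((List.range' i n).map kcol).count x = kcnt x (i + n) := by
  induction n with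
  | zero => simp
  | succ n ih =>
    rw [List.range'_concat, List.map_append, List.count_append, ← add_assoc, ih, ← add_assoc i n 1,
      kcnt]
    congr 1
    simp only [List.map_cons, List.map_nil, List.count_singleton, kcol, one_mul, beq_iff_eq,
      Fin.ext_iff]

/-- Two consecutive blocks of the word are never permutations of each other. -/
theorem kcol_no_perm (i n : ℕ) (hn : 0 < n)
    (h : List.Perm ((List.range' i n).map kcol) ((List.range' (i + n) n).map kcol)) : False := by
  refine kw_noAP (i + n + n) i (i + n) (by omega) (by omega) ?_
  intro x hx
  have h1 := kcol_count ⟨x, hx⟩ i n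
  have h2 := kcol_count ⟨x, hx⟩ (i + n) n
  have h3 := h.count_eq ⟨x, hx⟩
  simp only at h1 h2
  omega

/-- An ascending run of depths contains no anagram. -/
theorem kcol_asc {A B R : List (Fin 4)} {i l : ℕ} (hA : A ≠ []) (hp : List.Perm A B)
    (h : (List.range' i l).map kcol = A ++ B ++ R) : False := by
  have hlen := congrArg List.length h
  have hl := hp.length_eq
  have hA' := List.length_pos_iff.mpr hA
  simp only [List.length_map, List.length_range', List.length_append] at hlen
  have e : List.range' i l = List.range' i A.length ++ List.range' (i + A.length) A.length ++
      List.range' (i + A.length + A.length) R.length := by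
    rw [List.range'_append_1, add_assoc i, List.range'_append_1]
    congr 1
    omega
  rw [e, List.map_append, List.map_append] at h
  have h1 := List.append_inj_left h (by simp [hl])
  have h2 := List.append_inj h1 (by simp)
  refine kcol_no_perm i A.length hA' ?_
  rw [h2.1, h2.2]
  exact hp

/-- The same as `kcol_asc`, with an arbitrary prefix in front of the anagram. -/
theorem kcol_asc' {P A B R : List (Fin 4)} {i l : ℕ} (hA : A ≠ []) (hp : List.Perm A B)
    (h : (List.range' i l).map kcol = P ++ (A ++ B ++ R)) : False := by
  have h1 := congrArg (List.drop P.length) h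
  rw [List.drop_left, ← List.map_drop, List.drop_range'] at h1
  exact kcol_asc hA hp h1

theorem parent_unique {V : Type} {G : SimpleGraph V} (hG : G.IsTree) (o : V) {u v w : V}
    (hu : G.Adj u v) (hw : G.Adj w v) (du : G.dist o v = G.dist o u + 1)
    (dw : G.dist o v = G.dist o w + 1) : u = w := by
  obtain ⟨p, hp, hpl⟩ := (hG.connected o u).exists_path_of_dist
  obtain ⟨q, hq, hql⟩ := (hG.connected o w).exists_path_of_dist
  have hp' : (p.concat hu).IsPath :=
    SimpleGraph.Walk.isPath_of_length_eq_dist _ (by simp [hpl, du])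
  have hq' : (q.concat hw).IsPath :=
    SimpleGraph.Walk.isPath_of_length_eq_dist _ (by simp [hql, dw])
  have := (hG.isAcyclic.subsingleton_path o v).elim ⟨_, hp'⟩ ⟨_, hq'⟩
  have h2 := congrArg (fun z => z.1.penultimate) this
  simpa using h2

theorem path_asc {V : Type} {G : SimpleGraph V} (hG : G.IsTree) (o : V) {v w : V}
    (p : G.Walk v w) : ∀ {u : V} (h : G.Adj u v), (SimpleGraph.Walk.cons h p).IsPath →
    G.dist o v = G.dist o u + 1 →
    p.support.map (G.dist o) = List.range' (G.dist o v) p.support.length := by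
  induction p with
  | nil => intro u h hp hd; simp
  | @cons v v2 w h' p ih =>
    intro u h hp hd
    have hp2 := hp.of_cons
    rcases hG.dist_eq_dist_add_one_of_adj o h' with h1 | h1
    · exfalso
      have := parent_unique hG o h h'.symm hd h1
      subst this
      simp [SimpleGraph.Walk.cons_isPath_iff] at hp
    · have := ih h' hp2 h1
      simp only [SimpleGraph.Walk.support_cons, List.map_cons, List.length_cons,
        List.range'_succ, this, h1]

theorem path_shape {V : Type} {G : SimpleGraph V} (hG : G.IsTree) (o : V) {u v : V}
    (p : G.Walk u v) : p.IsPath → ∃ m a b, m + a = G.dist o u ∧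
      p.support.map (G.dist o) = (List.range' (m + 1) a).reverse ++ List.range' m b := by
  induction p with
  | nil => intro _; exact ⟨G.dist o _, 0, 1, rfl, by simp⟩
  | @cons u v w h p ih =>
    intro hp
    rcases hG.dist_eq_dist_add_one_of_adj o h with h1 | h1
    · obtain ⟨m, a, b, hm, e⟩ := ih hp.of_cons
      refine ⟨m, a + 1, b, by omega, ?_⟩
      rw [SimpleGraph.Walk.support_cons, List.map_cons, e, List.range'_concat, h1, ← hm]
      simp
      omega
    · refine ⟨G.dist o u, 0, p.support.length + 1, rfl, ?_⟩
      rw [SimpleGraph.Walk.support_cons, List.map_cons, path_asc hG o p h hp h1, h1,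
        List.range'_succ]
      simp

/-- For every `k ≥ 4`, every tree has a `k`-anagram-free
vertex colouring using at most `4` colours: `φ_k(T) ≤ 4`. -/
theorem kAnagramFree_chromatic_le_four_of_tree (k : ℕ) (hk : 4 ≤ k)
    {V : Type} [Finite V] (G : SimpleGraph V) (hG : G.IsTree) :
    ∃ f : V → Fin 4, KAnagramFreeVC k G f := by
  obtain ⟨o⟩ := hG.connected.nonempty
  refine ⟨fun v => kcol (G.dist o v), ?_⟩
  rintro u v p hp ⟨W, ws, hW, hlen, hperm, heq⟩
  obtain ⟨m, a, b, -, e⟩ := path_shape hG o p hp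
  have e2 : p.support.map (fun v => kcol (G.dist o v)) =
      ((List.range' (m + 1) a).map kcol).reverse ++ (List.range' m b).map kcol := by
    rw [← List.map_reverse, ← List.map_append, ← e, List.map_map]; rfl
  rw [e2] at heq
  obtain ⟨A, B, C, D, rest, rfl⟩ : ∃ A B C D rest, ws = A :: B :: C :: D :: rest := by
    match ws, hlen with
    | A :: B :: C :: D :: rest, _ => exact ⟨A, B, C, D, rest, rfl⟩
    | [_, _, _], h => simp at h; omega
    | [_, _], h => simp at h; omega
    | [_], h => simp at h; omega
    | [], h => simp at h; omega
  have hA := hperm A (by simp)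
  have hB := hperm B (by simp)
  have hC := hperm C (by simp)
  have hD := hperm D (by simp)
  have neA : A ≠ [] := fun h => hW (by simpa [h] using hA.symm)
  have neB : B ≠ [] := fun h => hW (by simpa [h] using hB.symm)
  have neC : C ≠ [] := fun h => hW (by simpa [h] using hC.symm)
  have heq' : ((List.range' (m + 1) a).map kcol).reverse ++ (List.range' m b).map kcol =
      (A ++ B) ++ ((C ++ D) ++ rest.flatten) := by
    rw [heq]; simp
  rcases List.append_eq_append_iff.mp heq' with ⟨X, h1, h2⟩ | ⟨X, h1, h2⟩
  · -- the descending part lies inside `A ++ B`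
    exact kcol_asc' neC (hC.trans hD.symm) h2
  · -- `A ++ B` lies inside the descending part
    have h3 := congrArg List.reverse h1
    rw [List.reverse_reverse, List.reverse_append, List.reverse_append] at h3
    refine kcol_asc' (P := X.reverse) (A := B.reverse) (B := A.reverse) (R := []) (by simpa using neB)
      ?_ (by simpa using h3)
    exact (List.reverse_perm B).trans ((hB.trans hA.symm).trans (List.reverse_perm A).symm)
end
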